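/- Fix a finite POMDP and depth-indexed topologies β, β' : ℕ → Bool such that β' d = true implies β d = true for every depth d (β' uses simplified steps at a subset of the depths where β does). Then for every depth d, horizon n and belief b: V^{AOL}_β d n b ≤ V^{AOL}_{β'} d n b and V^{AFO}_{β'} d n b ≤ V^{AFO}_β d n b; i.e., converting simplified steps to closed-loop steps monotonically tightens both the lower and the upper bound. (Monotonicity of the bounds under topology refinement, Appendix bound analysis.) -/

import Mathlib

open Finset

set_option maxHeartbeats 1000000

attribute [local instance] Classical.propDecidable

/-- A finite POMDP: transition kernel, observation kernel and reward. -/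
structure POMDP (X A Z : Type) where
  T : X → A → PMF X
  O : X → PMF Z
  r : X → A → ℝ

namespace POMDP

variable {X A Z : Type} [Fintype X] [Fintype A] [Fintype Z]
variable [Nonempty X] [Nonempty A] [Nonempty Z]

/-- Real-valued transition probability. -/
noncomputable def Tr (M : POMDP X A Z) (x : X) (a : A) (x' : X) : ℝ :=
  ((M.T x a) x').toReal

/-- Real-valued observation probability. -/
noncomputable def Ob (M : POMDP X A Z) (x : X) (z : Z) : ℝ :=
  ((M.O x) z).toReal

/-- A belief: nonnegative and sums to one. -/
def IsBelief (b : X → ℝ) : Prop :=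
  (∀ x, 0 ≤ b x) ∧ ∑ x, b x = 1

/-- The propagated belief `b·a`. -/
noncomputable def prop (M : POMDP X A Z) (b : X → ℝ) (a : A) : X → ℝ :=
  fun x' => ∑ x, b x * M.Tr x a x'

/-- Expected reward `R(b,a)`. -/
noncomputable def Rew (M : POMDP X A Z) (b : X → ℝ) (a : A) : ℝ :=
  ∑ x, b x * M.r x a

/-- Observation likelihood `P(z ∣ b, a)`. -/
noncomputable def obsLik (M : POMDP X A Z) (z : Z) (b : X → ℝ) (a : A) : ℝ :=
  ∑ x', M.prop b a x' * M.Ob x' z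

/-- Bayes posterior `b^{a,z}`. -/
noncomputable def post (M : POMDP X A Z) (b : X → ℝ) (a : A) (z : Z) : X → ℝ :=
  fun x' => M.Ob x' z * M.prop b a x' / M.obsLik z b a

/-- Closed-loop optimal value `V`. -/
noncomputable def V (M : POMDP X A Z) : ℕ → (X → ℝ) → ℝ
  | 0, _ => 0
  | n + 1, b =>
    Finset.univ.sup' Finset.univ_nonempty fun a =>
      M.Rew b a +
        ∑ z ∈ Finset.univ.filter (fun z => 0 < M.obsLik z b a),
          M.obsLik z b a * V M n (M.post b a z)

/-- Closed-loop optimal Q-function `Q`. -/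
noncomputable def Q (M : POMDP X A Z) : ℕ → (X → ℝ) → A → ℝ
  | 0, _, _ => 0
  | n + 1, b, a =>
    M.Rew b a +
      ∑ z ∈ Finset.univ.filter (fun z => 0 < M.obsLik z b a),
        M.obsLik z b a * V M n (M.post b a z)

/-- Open-loop optimal value `W`. -/
noncomputable def W (M : POMDP X A Z) : ℕ → (X → ℝ) → ℝ
  | 0, _ => 0
  | n + 1, b =>
    Finset.univ.sup' Finset.univ_nonempty fun a =>
      M.Rew b a + W M n (M.prop b a)

/-- Open-loop Q-function `Q^{OL}`. -/
noncomputable def QOL (M : POMDP X A Z) : ℕ → (X → ℝ) → A → ℝ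
  | 0, _, _ => 0
  | n + 1, b, a => M.Rew b a + W M n (M.prop b a)

/-- Fully observable (MDP) optimal value `U`. -/
noncomputable def U (M : POMDP X A Z) : ℕ → X → ℝ
  | 0, _ => 0
  | n + 1, x =>
    Finset.univ.sup' Finset.univ_nonempty fun a =>
      M.r x a + ∑ x', M.Tr x a x' * U M n x'

/-- QMDP Q-function `Q^{FO}`. -/
noncomputable def QFO (M : POMDP X A Z) : ℕ → (X → ℝ) → A → ℝ
  | 0, _, _ => 0
  | n + 1, b, a => M.Rew b a + ∑ x', M.prop b a x' * U M n x'

/-- Adaptive open-loop optimal value `V^{AOL}_β` on histories of actions and observations. -/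
noncomputable def VAOL (M : POMDP X A Z) (β : List (A ⊕ Z) → Bool) :
    ℕ → (X → ℝ) → List (A ⊕ Z) → ℝ
  | 0, _, _ => 0
  | n + 1, b, h =>
    Finset.univ.sup' Finset.univ_nonempty fun a =>
      M.Rew b a +
        (if β h = true then VAOL M β n (M.prop b a) (h ++ [Sum.inl a])
        else
          ∑ z ∈ Finset.univ.filter (fun z => 0 < M.obsLik z b a),
            M.obsLik z b a * VAOL M β n (M.post b a z) (h ++ [Sum.inl a, Sum.inr z]))

/-- Adaptive open-loop Q-function `Q^{AOL}_β`. -/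
noncomputable def QAOL (M : POMDP X A Z) (β : List (A ⊕ Z) → Bool) :
    ℕ → (X → ℝ) → A → List (A ⊕ Z) → ℝ
  | 0, _, _, _ => 0
  | n + 1, b, a, h =>
    M.Rew b a +
      (if β h = true then VAOL M β n (M.prop b a) (h ++ [Sum.inl a])
      else
        ∑ z ∈ Finset.univ.filter (fun z => 0 < M.obsLik z b a),
          M.obsLik z b a * VAOL M β n (M.post b a z) (h ++ [Sum.inl a, Sum.inr z]))

/-- Point-mass belief at `x'`. -/
noncomputable def delta (x' : X) : X → ℝ := fun x => if x = x' then 1 else 0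

/-- Adaptive fully-observable optimal value `V^{AFO}_β` on histories of
actions, observations and states. -/
noncomputable def VAFO (M : POMDP X A Z) (β : List (A ⊕ (Z ⊕ X)) → Bool) :
    ℕ → (X → ℝ) → List (A ⊕ (Z ⊕ X)) → ℝ
  | 0, _, _ => 0
  | n + 1, b, h =>
    Finset.univ.sup' Finset.univ_nonempty fun a =>
      M.Rew b a +
        (if β h = true then
          ∑ x', M.prop b a x' *
            VAFO M β n (delta x') (h ++ [Sum.inl a, Sum.inr (Sum.inr x')])
        else
          ∑ z ∈ Finset.univ.filter (fun z => 0 < M.obsLik z b a),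
            M.obsLik z b a *
              VAFO M β n (M.post b a z) (h ++ [Sum.inl a, Sum.inr (Sum.inl z)]))

/-- Adaptive fully-observable Q-function `Q^{AFO}_β`. -/
noncomputable def QAFO (M : POMDP X A Z) (β : List (A ⊕ (Z ⊕ X)) → Bool) :
    ℕ → (X → ℝ) → A → List (A ⊕ (Z ⊕ X)) → ℝ
  | 0, _, _, _ => 0
  | n + 1, b, a, h =>
    M.Rew b a +
      (if β h = true then
        ∑ x', M.prop b a x' *
          VAFO M β n (delta x') (h ++ [Sum.inl a, Sum.inr (Sum.inr x')])
      else
        ∑ z ∈ Finset.univ.filter (fun z => 0 < M.obsLik z b a),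
          M.obsLik z b a *
            VAFO M β n (M.post b a z) (h ++ [Sum.inl a, Sum.inr (Sum.inl z)]))

/-- Depth-indexed adaptive open-loop value. -/
noncomputable def VAOLd (M : POMDP X A Z) (β : ℕ → Bool) : ℕ → ℕ → (X → ℝ) → ℝ
  | _, 0, _ => 0
  | d, n + 1, b =>
    Finset.univ.sup' Finset.univ_nonempty fun a =>
      M.Rew b a +
        (if β d = true then VAOLd M β (d + 1) n (M.prop b a)
        else
          ∑ z ∈ Finset.univ.filter (fun z => 0 < M.obsLik z b a),
            M.obsLik z b a * VAOLd M β (d + 1) n (M.post b a z))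

/-- Depth-indexed adaptive fully-observable value. -/
noncomputable def VAFOd (M : POMDP X A Z) (β : ℕ → Bool) : ℕ → ℕ → (X → ℝ) → ℝ
  | _, 0, _ => 0
  | d, n + 1, b =>
    Finset.univ.sup' Finset.univ_nonempty fun a =>
      M.Rew b a +
        (if β d = true then
          ∑ x', M.prop b a x' * VAFOd M β (d + 1) n (delta x')
        else
          ∑ z ∈ Finset.univ.filter (fun z => 0 < M.obsLik z b a),
            M.obsLik z b a * VAFOd M β (d + 1) n (M.post b a z))

/-- Open-loop propagated beliefs `φ₀ = b`, `φ_{i+1} = φ_i · a i` along a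
finite action sequence. -/
noncomputable def propFin (M : POMDP X A Z) (b : X → ℝ) {n : ℕ} (a : Fin n → A)
    (j : Fin (n + 1)) : X → ℝ :=
  Fin.induction b (fun i ih => M.prop ih (a i)) j

end POMDP

namespace POMDP

/-- Sublinear functions on the nonnegative cone. -/
structure SubLin {X : Type} (f : (X → ℝ) → ℝ) : Prop where
  hom : ∀ (c : ℝ) (b : X → ℝ), 0 ≤ c → 0 ≤ b → f (c • b) = c * f b
  add : ∀ b₁ b₂ : X → ℝ, 0 ≤ b₁ → 0 ≤ b₂ → f (b₁ + b₂) ≤ f b₁ + f b₂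

section
variable {X A Z : Type}

theorem SubLin.zero {f : (X → ℝ) → ℝ} (hf : SubLin f) : f 0 = 0 := by
  have := hf.hom 0 0 le_rfl le_rfl
  simpa using this

theorem SubLin.sum_le {ι : Type} {f : (X → ℝ) → ℝ} (hf : SubLin f) (s : Finset ι)
    (g : ι → X → ℝ) (hg : ∀ i, 0 ≤ g i) : f (∑ i ∈ s, g i) ≤ ∑ i ∈ s, f (g i) := by
  classical
  induction s using Finset.induction_on with
  | empty => simp [hf.zero]
  | insert i s hi ih =>
    rw [Finset.sum_insert hi, Finset.sum_insert hi]
    have := hf.add (g i) (∑ i ∈ s, g i) (hg i) (Finset.sum_nonneg fun j _ => hg j)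
    linarith

theorem SubLin.padd {f g : (X → ℝ) → ℝ} (hf : SubLin f) (hg : SubLin g) :
    SubLin (fun b => f b + g b) where
  hom c b hc hb := by simp only [hf.hom c b hc hb, hg.hom c b hc hb]; ring
  add b₁ b₂ h₁ h₂ := by
    have := hf.add b₁ b₂ h₁ h₂
    have := hg.add b₁ b₂ h₁ h₂
    linarith

theorem SubLin.psum {ι : Type} [Fintype ι] {f : ι → (X → ℝ) → ℝ} (hf : ∀ i, SubLin (f i)) :
    SubLin (fun b => ∑ i, f i b) where
  hom c b hc hb := by
    rw [Finset.mul_sum]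
    exact Finset.sum_congr rfl fun i _ => (hf i).hom c b hc hb
  add b₁ b₂ h₁ h₂ := by
    rw [← Finset.sum_add_distrib]
    exact Finset.sum_le_sum fun i _ => (hf i).add b₁ b₂ h₁ h₂

theorem SubLin.psup [Fintype A] [Nonempty A] {f : A → (X → ℝ) → ℝ} (hf : ∀ i, SubLin (f i)) :
    SubLin (fun b => Finset.univ.sup' Finset.univ_nonempty fun a => f a b) where
  hom c b hc hb := by
    simp only [(hf _).hom c b hc hb]
    rw [Finset.mul₀_sup' hc]
  add b₁ b₂ h₁ h₂ := by
    refine Finset.sup'_le _ _ fun a _ => ((hf a).add b₁ b₂ h₁ h₂).trans ?_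
    exact add_le_add (Finset.le_sup' (fun a => f a b₁) (Finset.mem_univ a))
      (Finset.le_sup' (fun a => f a b₂) (Finset.mem_univ a))

theorem SubLin.comp {f : (X → ℝ) → ℝ} (hf : SubLin f) (L : (X → ℝ) → (X → ℝ))
    (hs : ∀ (c : ℝ) b, L (c • b) = c • L b) (ha : ∀ b₁ b₂, L (b₁ + b₂) = L b₁ + L b₂)
    (hL : ∀ b, 0 ≤ b → 0 ≤ L b) : SubLin (fun b => f (L b)) where
  hom c b hc hb := by rw [hs]; exact hf.hom c _ hc (hL b hb)
  add b₁ b₂ h₁ h₂ := by rw [ha]; exact hf.add _ _ (hL _ h₁) (hL _ h₂)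

theorem Tr_nonneg (M : POMDP X A Z) (x : X) (a : A) (x' : X) : 0 ≤ M.Tr x a x' :=
  ENNReal.toReal_nonneg

theorem Ob_nonneg (M : POMDP X A Z) (x : X) (z : Z) : 0 ≤ M.Ob x z :=
  ENNReal.toReal_nonneg

theorem Ob_sum [Fintype Z] (M : POMDP X A Z) (x : X) : ∑ z, M.Ob x z = 1 := by
  unfold Ob
  rw [← ENNReal.toReal_sum (fun z _ => (M.O x).apply_ne_top z)]
  have := (M.O x).tsum_coe
  rw [tsum_fintype] at this
  rw [this]; rfl

variable [Fintype X]

theorem prop_nonneg (M : POMDP X A Z) (b : X → ℝ) (a : A) (hb : 0 ≤ b) : 0 ≤ M.prop b a :=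
  fun x' => Finset.sum_nonneg fun x _ => mul_nonneg (hb x) (M.Tr_nonneg x a x')

theorem prop_smul (M : POMDP X A Z) (a : A) (c : ℝ) (b : X → ℝ) :
    M.prop (c • b) a = c • M.prop b a := by
  funext x'
  simp [prop, Finset.mul_sum, mul_assoc]

theorem prop_add (M : POMDP X A Z) (a : A) (b₁ b₂ : X → ℝ) :
    M.prop (b₁ + b₂) a = M.prop b₁ a + M.prop b₂ a := by
  funext x'
  simp [prop, add_mul, Finset.sum_add_distrib]

/-- Unnormalized posterior. -/
noncomputable def upost (M : POMDP X A Z) (b : X → ℝ) (a : A) (z : Z) : X → ℝ :=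
  fun x' => M.Ob x' z * M.prop b a x'

theorem upost_nonneg (M : POMDP X A Z) (b : X → ℝ) (a : A) (z : Z) (hb : 0 ≤ b) :
    0 ≤ M.upost b a z :=
  fun x' => mul_nonneg (M.Ob_nonneg x' z) (M.prop_nonneg b a hb x')

theorem obsLik_nonneg (M : POMDP X A Z) (b : X → ℝ) (a : A) (z : Z) (hb : 0 ≤ b) :
    0 ≤ M.obsLik z b a :=
  Finset.sum_nonneg fun x' _ => mul_nonneg (M.prop_nonneg b a hb x') (M.Ob_nonneg x' z)

theorem post_nonneg (M : POMDP X A Z) (b : X → ℝ) (a : A) (z : Z) (hb : 0 ≤ b) :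
    0 ≤ M.post b a z :=
  fun x' => div_nonneg (M.upost_nonneg b a z hb x') (M.obsLik_nonneg b a z hb)

theorem sum_upost [Fintype Z] (M : POMDP X A Z) (b : X → ℝ) (a : A) :
    ∑ z, M.upost b a z = M.prop b a := by
  funext x'
  simp [upost, ← Finset.sum_mul, Ob_sum]

theorem sum_post_eq [Fintype Z] (M : POMDP X A Z) {f : (X → ℝ) → ℝ} (hf : SubLin f)
    (b : X → ℝ) (a : A) (hb : 0 ≤ b) :
    ∑ z ∈ Finset.univ.filter (fun z => 0 < M.obsLik z b a),
      M.obsLik z b a * f (M.post b a z) = ∑ z, f (M.upost b a z) := by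
  rw [Finset.sum_filter]
  refine Finset.sum_congr rfl fun z _ => ?_
  split_ifs with h
  · rw [← hf.hom _ _ h.le (M.post_nonneg b a z hb)]
    congr 1
    funext x'
    simp only [post, upost, Pi.smul_apply, smul_eq_mul]
    field_simp
  · have h0 : M.obsLik z b a = 0 := le_antisymm (not_lt.mp h) (M.obsLik_nonneg b a z hb)
    have : M.upost b a z = 0 := by
      funext x'
      have := (Finset.sum_eq_zero_iff_of_nonneg (fun x' _ =>
        mul_nonneg (M.prop_nonneg b a hb x') (M.Ob_nonneg x' z))).mp h0 x' (Finset.mem_univ _)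
      simpa [upost, mul_comm] using this
    rw [this, hf.zero]

theorem SubLin.congr {f g : (X → ℝ) → ℝ} (hg : SubLin g) (h : ∀ b, 0 ≤ b → f b = g b) :
    SubLin f where
  hom c b hc hb := by
    rw [h _ hb, h _ (smul_nonneg hc hb)]; exact hg.hom c b hc hb
  add b₁ b₂ h₁ h₂ := by
    rw [h _ h₁, h _ h₂, h _ (add_nonneg h₁ h₂)]; exact hg.add b₁ b₂ h₁ h₂

theorem subLin_lin (w : X → ℝ) : SubLin (fun b : X → ℝ => ∑ x, b x * w x) where
  hom c b _ _ := by simp [Finset.mul_sum, mul_assoc]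
  add b₁ b₂ _ _ := by simp [add_mul, Finset.sum_add_distrib]

theorem subLin_prop (M : POMDP X A Z) {f : (X → ℝ) → ℝ} (hf : SubLin f) (a : A) :
    SubLin (fun b => f (M.prop b a)) :=
  hf.comp (fun b => M.prop b a) (M.prop_smul a) (M.prop_add a) (fun b hb => M.prop_nonneg b a hb)

theorem subLin_post [Fintype Z] (M : POMDP X A Z) {f : (X → ℝ) → ℝ} (hf : SubLin f) (a : A) :
    SubLin (fun b => ∑ z ∈ Finset.univ.filter (fun z => 0 < M.obsLik z b a),
      M.obsLik z b a * f (M.post b a z)) := by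
  refine SubLin.congr (g := fun b => ∑ z, f (M.upost b a z)) ?_
    (fun b hb => M.sum_post_eq hf b a hb)
  refine SubLin.psum fun z => hf.comp (fun b => M.upost b a z) ?_ ?_
    (fun b hb => M.upost_nonneg b a z hb)
  · intro c b
    funext x'
    simp only [upost, prop_smul, Pi.smul_apply, smul_eq_mul]
    ring
  · intro b₁ b₂
    funext x'
    simp only [upost, prop_add, Pi.add_apply]
    ring

theorem SubLin.le_delta {f : (X → ℝ) → ℝ} (hf : SubLin f) (b : X → ℝ) (hb : 0 ≤ b) :
    f b ≤ ∑ x, b x * f (delta x) := by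
  have hd : ∀ x : X, (0 : X → ℝ) ≤ delta x := fun x y => by
    simp only [delta, Pi.zero_apply]; split_ifs <;> norm_num
  have h := hf.sum_le Finset.univ (fun x => b x • (delta x : X → ℝ))
    (fun x => smul_nonneg (hb x) (hd x))
  have e : ∑ x, b x • (delta x : X → ℝ) = b := by
    funext y
    simp [delta, Finset.sum_apply]
  rw [e] at h
  refine h.trans (le_of_eq (Finset.sum_congr rfl fun x _ => hf.hom _ _ (hb x) (hd x)))

variable [Fintype A] [Fintype Z] [Nonempty A]

theorem subLin_VAOLd (M : POMDP X A Z) (β : ℕ → Bool) (n : ℕ) :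
    ∀ d, SubLin (M.VAOLd β d n) := by
  induction n with
  | zero => exact fun d => ⟨fun c b _ _ => by simp [VAOLd], fun _ _ _ _ => by simp [VAOLd]⟩
  | succ n ih =>
    intro d
    refine SubLin.congr (SubLin.psup fun a => SubLin.padd (subLin_lin fun x => M.r x a)
      (?_ : SubLin fun b => if β d = true then M.VAOLd β (d + 1) n (M.prop b a)
        else ∑ z ∈ Finset.univ.filter (fun z => 0 < M.obsLik z b a),
            M.obsLik z b a * M.VAOLd β (d + 1) n (M.post b a z))) (fun b _ => rfl)
    by_cases h : β d = true
    · simp only [h, if_true]; exact M.subLin_prop (ih _) a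
    · simp only [h, if_false]; exact M.subLin_post (ih _) a

theorem subLin_VAFOd (M : POMDP X A Z) (β : ℕ → Bool) (n : ℕ) :
    ∀ d, SubLin (M.VAFOd β d n) := by
  induction n with
  | zero => exact fun d => ⟨fun c b _ _ => by simp [VAFOd], fun _ _ _ _ => by simp [VAFOd]⟩
  | succ n ih =>
    intro d
    refine SubLin.congr (SubLin.psup fun a => SubLin.padd (subLin_lin fun x => M.r x a)
      (?_ : SubLin fun b => if β d = true then
          ∑ x', M.prop b a x' * M.VAFOd β (d + 1) n (delta x')
        else ∑ z ∈ Finset.univ.filter (fun z => 0 < M.obsLik z b a),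
            M.obsLik z b a * M.VAFOd β (d + 1) n (M.post b a z))) (fun b _ => rfl)
    by_cases h : β d = true
    · simp only [h, if_true]
      exact M.subLin_prop (subLin_lin fun x' => M.VAFOd β (d + 1) n (delta x')) a
    · simp only [h, if_false]; exact M.subLin_post (ih _) a

theorem refine_aux (M : POMDP X A Z) (β β' : ℕ → Bool)
    (hsub : ∀ d : ℕ, β' d = true → β d = true) (n : ℕ) :
    ∀ (d : ℕ) (b : X → ℝ), 0 ≤ b →
      M.VAOLd β d n b ≤ M.VAOLd β' d n b ∧ M.VAFOd β' d n b ≤ M.VAFOd β d n b := by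
  induction n with
  | zero => intro d b _; simp [VAOLd, VAFOd]
  | succ n ih =>
    intro d b hb
    have hd : ∀ x : X, (0 : X → ℝ) ≤ delta x := fun x y => by
      simp only [delta, Pi.zero_apply]; split_ifs <;> norm_num
    have hO : ∀ a, ∑ z ∈ Finset.univ.filter (fun z => 0 < M.obsLik z b a),
          M.obsLik z b a * M.VAOLd β (d + 1) n (M.post b a z) ≤
        ∑ z ∈ Finset.univ.filter (fun z => 0 < M.obsLik z b a),
          M.obsLik z b a * M.VAOLd β' (d + 1) n (M.post b a z) := fun a =>
      Finset.sum_le_sum fun z _ => mul_le_mul_of_nonneg_left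
        (ih (d + 1) _ (M.post_nonneg b a z hb)).1 (M.obsLik_nonneg b a z hb)
    have hF : ∀ a, ∑ z ∈ Finset.univ.filter (fun z => 0 < M.obsLik z b a),
          M.obsLik z b a * M.VAFOd β' (d + 1) n (M.post b a z) ≤
        ∑ z ∈ Finset.univ.filter (fun z => 0 < M.obsLik z b a),
          M.obsLik z b a * M.VAFOd β (d + 1) n (M.post b a z) := fun a =>
      Finset.sum_le_sum fun z _ => mul_le_mul_of_nonneg_left
        (ih (d + 1) _ (M.post_nonneg b a z hb)).2 (M.obsLik_nonneg b a z hb)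
    constructor
    · simp only [VAOLd]
      refine Finset.sup'_mono_fun fun a _ => add_le_add le_rfl ?_
      by_cases h' : β' d = true
      · rw [if_pos h', if_pos (hsub d h')]
        exact (ih (d + 1) _ (M.prop_nonneg b a hb)).1
      · rw [if_neg h']
        split_ifs with h
        · refine le_trans ?_ (hO a)
          rw [M.sum_post_eq (M.subLin_VAOLd β n (d + 1)) b a hb]
          conv_lhs => rw [← M.sum_upost b a]
          exact (M.subLin_VAOLd β n (d + 1)).sum_le _ _ fun z => M.upost_nonneg b a z hb
        · exact hO a
    · simp only [VAFOd]
      refine Finset.sup'_mono_fun fun a _ => add_le_add le_rfl ?_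
      by_cases h' : β' d = true
      · rw [if_pos h', if_pos (hsub d h')]
        exact Finset.sum_le_sum fun x' _ => mul_le_mul_of_nonneg_left
          (ih (d + 1) _ (hd x')).2 (M.prop_nonneg b a hb x')
      · rw [if_neg h']
        split_ifs with h
        · refine (hF a).trans ?_
          rw [M.sum_post_eq (M.subLin_VAFOd β n (d + 1)) b a hb]
          refine (Finset.sum_le_sum fun z _ => (M.subLin_VAFOd β n (d + 1)).le_delta _
            (M.upost_nonneg b a z hb)).trans (le_of_eq ?_)
          rw [Finset.sum_comm]
          refine Finset.sum_congr rfl fun x' _ => ?_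
          rw [← Finset.sum_mul, ← M.sum_upost b a, Finset.sum_apply]
        · exact hF a

end

end POMDP

/-- monotonicity of the bounds under topology refinement:
if `β'` uses simplified steps at a subset of the depths where `β` does, then
converting simplified steps to closed-loop steps monotonically tightens both
the adaptive open-loop lower bound and the adaptive fully-observable upper
bound. -/
theorem topology_refinement_monotone {X A Z : Type}
    [Fintype X] [Fintype A] [Fintype Z]
    [Nonempty X] [Nonempty A] [Nonempty Z]
    (M : POMDP X A Z) (β β' : ℕ → Bool)
    (hsub : ∀ d : ℕ, β' d = true → β d = true) :
    ∀ (d n : ℕ) (b : X → ℝ), POMDP.IsBelief b →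
      M.VAOLd β d n b ≤ M.VAOLd β' d n b ∧
        M.VAFOd β' d n b ≤ M.VAFOd β d n b := by
  intro d n b hb
  exact M.refine_aux β β' hsub n d b hb.1
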